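/- Let G be the 9 × 9 real symmetric matrix with all diagonal entries equal to 1 and off-diagonal entries (symmetrically extended) G₁₂ = −1, G₁₃ = −2√10/5, G₂₄ = −2√10/5, G₄₅ = −1/2, G₃₉ = −1/2, G₅₆ = −1/2, G₆₇ = −1/2, G₇₈ = −1/2, G₈₉ = −1/2, G₅₉ = −1/2, and all other off-diagonal entries 0 (so indices 5–9 form a 5-cycle). Then G has exactly 6 positive eigenvalues (with multiplicity), exactly 1 negative eigenvalue, and exactly 2 zero eigenvalues; equivalently G has rank 7 and signature (6,1). -/

import Mathlib

open Real

noncomputable def G12 : Matrix (Fin 9) (Fin 9) ℝ :=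
  !![1, -1, -(2 * Real.sqrt 10 / 5), 0, 0, 0, 0, 0, 0;
     -1, 1, 0, -(2 * Real.sqrt 10 / 5), 0, 0, 0, 0, 0;
     -(2 * Real.sqrt 10 / 5), 0, 1, 0, 0, 0, 0, 0, -(1/2);
     0, -(2 * Real.sqrt 10 / 5), 0, 1, -(1/2), 0, 0, 0, 0;
     0, 0, 0, -(1/2), 1, -(1/2), 0, 0, -(1/2);
     0, 0, 0, 0, -(1/2), 1, -(1/2), 0, 0;
     0, 0, 0, 0, 0, -(1/2), 1, -(1/2), 0;
     0, 0, 0, 0, 0, 0, -(1/2), 1, -(1/2);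
     0, 0, -(1/2), 0, -(1/2), 0, 0, -(1/2), 1]

namespace Matrix

variable {n : Type*} [Fintype n] [DecidableEq n]

open QuadraticMap in
lemma equivalent_weightedSumSquares_of_eq_transpose_mul_diagonal_mul {A B : Matrix n n ℝ}
    {w : n → ℝ} (hB : IsUnit B) (hA : A = Bᵀ * diagonal w * B) :
    Equivalent A.toQuadraticForm' (weightedSumSquares ℝ w) := by
  have := hB.invertible
  refine ⟨⟨Matrix.toLinearEquiv' B this, fun x => ?_⟩⟩
  subst hA
  simp only [toQuadraticForm', LinearMap.BilinMap.toQuadraticMap_apply, toLinearMap₂'_apply',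
    weightedSumSquares_apply]
  change ∑ i, w i • ((B *ᵥ x) i * (B *ᵥ x) i) = _
  rw [← mulVec_mulVec, ← mulVec_mulVec, dotProduct_mulVec, vecMul_transpose]
  simp only [dotProduct, mulVec_diagonal, smul_eq_mul]
  exact Finset.sum_congr rfl fun i _ => by ring

namespace IsHermitian

lemma equivalent_weightedSumSquares_eigenvalues {A : Matrix n n ℝ} (hA : A.IsHermitian) :
    QuadraticMap.Equivalent A.toQuadraticForm'
      (QuadraticMap.weightedSumSquares ℝ hA.eigenvalues) := by
  refine equivalent_weightedSumSquares_of_eq_transpose_mul_diagonal_mul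
    (B := (hA.eigenvectorUnitary : Matrix n n ℝ)ᵀ) ?_ ?_
  · exact (Matrix.isUnit_transpose _).2 (Unitary.toUnits hA.eigenvectorUnitary).isUnit
  · conv_lhs => rw [hA.spectral_theorem]
    rw [Unitary.conjStarAlgAut_apply, star_eq_conjTranspose, conjTranspose_eq_transpose_of_trivial,
      transpose_transpose]
    rfl

variable {A B : Matrix n n ℝ} {w : n → ℝ}

/-- **Sylvester's law of inertia** for the positive eigenvalues of a real symmetric matrix. -/
lemma card_eigenvalues_pos_eq (hA : A.IsHermitian) (hB : IsUnit B)
    (h : A = Bᵀ * diagonal w * B) :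
    (Finset.univ.filter fun j => 0 < hA.eigenvalues j).card =
      (Finset.univ.filter fun j => 0 < w j).card := by
  have h₁ := QuadraticForm.sigPos_of_equiv_weightedSumSquares
    hA.equivalent_weightedSumSquares_eigenvalues
  rw [QuadraticForm.sigPos_of_equiv_weightedSumSquares
    (equivalent_weightedSumSquares_of_eq_transpose_mul_diagonal_mul hB h)] at h₁
  simpa [Set.ncard_eq_toFinset_card'] using h₁.symm

/-- **Sylvester's law of inertia** for the negative eigenvalues of a real symmetric matrix. -/
lemma card_eigenvalues_neg_eq (hA : A.IsHermitian) (hB : IsUnit B)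
    (h : A = Bᵀ * diagonal w * B) :
    (Finset.univ.filter fun j => hA.eigenvalues j < 0).card =
      (Finset.univ.filter fun j => w j < 0).card := by
  have h₁ := QuadraticForm.sigNeg_of_equiv_weightedSumSquares
    hA.equivalent_weightedSumSquares_eigenvalues
  rw [QuadraticForm.sigNeg_of_equiv_weightedSumSquares
    (equivalent_weightedSumSquares_of_eq_transpose_mul_diagonal_mul hB h)] at h₁
  simpa [Set.ncard_eq_toFinset_card'] using h₁.symm

end IsHermitian

end Matrix

open Matrix

/-- The change of coordinates that diagonalizes the quadratic form of `G12`. -/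
noncomputable def diagonalizer : Matrix (Fin 9) (Fin 9) ℝ :=
  !![1, 0, 0, 0, 0, 0, 0, 0, 0;
     0, 1, 0, 0, 0, 0, 0, 0, 0;
     -(2 * √10 / 5), 0, 1, 0, 0, 0, 0, 0, -(1/2);
     0, -(2 * √10 / 3), 0, 1, 0, 0, 0, 0, -(5/6);
     0, 0, 0, -(1/2), 1, -(1/2), 0, 0, -(1/2);
     0, 0, 0, -(1/3), 0, 1, -(2/3), 0, -(1/3);
     0, 0, 0, -(1/4), 0, 0, 1, -(3/4), -(1/4);
     0, 0, 0, -(1/5), 0, 0, 0, 1, -1;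
     3 * √10 / 10, √10 / 2, 0, 0, 0, 0, 0, 0, 1]

/-- The diagonal entries of `G12` in the coordinates given by `diagonalizer`. -/
noncomputable def pivots : Fin 9 → ℝ := ![0, 0, 1, 3/5, 1, 3/4, 2/3, 5/8, -(2/3)]

lemma filter_pivots_pos : (Finset.univ.filter fun j => 0 < pivots j) = {2, 3, 4, 5, 6, 7} := by
  ext i
  rw [Finset.mem_filter_univ]
  fin_cases i <;> simp [pivots]
  positivity

lemma filter_pivots_neg : (Finset.univ.filter fun j => pivots j < 0) = {8} := by
  ext i
  rw [Finset.mem_filter_univ]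
  fin_cases i <;> simp [pivots] <;> positivity

lemma isUnit_diagonalizer : IsUnit diagonalizer := by
  rw [← mulVec_injective_iff_isUnit]
  refine (injective_iff_map_eq_zero diagonalizer.mulVecLin).2 fun x hx => ?_
  have h (i) : (diagonalizer *ᵥ x) i = 0 := congrFun hx i
  simp only [mulVec, dotProduct, diagonalizer, Fin.sum_univ_succ, Fin.forall_fin_succ] at h
  simp at h
  obtain ⟨h0, h1, h2, h3, h4, h5, h6, h7, h8⟩ := h
  simp only [h0, h1] at h2 h3 h8
  ext i
  fin_cases i <;> simp <;> linarith

lemma G12_eq_transpose_mul_diagonal_mul :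
    G12 = diagonalizerᵀ * diagonal pivots * diagonalizer := by
  have hs : √10 * √10 = 10 := Real.mul_self_sqrt (by norm_num)
  ext i j
  rw [mul_apply]
  simp only [mul_diagonal, transpose_apply]
  fin_cases i <;> fin_cases j <;>
    simp [G12, diagonalizer, pivots, Fin.sum_univ_succ] <;> linarith

theorem stmt_12 (hG : G12.IsHermitian) :
    (Finset.univ.filter fun j => 0 < hG.eigenvalues j).card = 6 ∧
    (Finset.univ.filter fun j => hG.eigenvalues j < 0).card = 1 ∧
    (Finset.univ.filter fun j => hG.eigenvalues j = 0).card = 2 ∧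
    G12.rank = 7 := by
  have hpos : (Finset.univ.filter fun j => 0 < hG.eigenvalues j).card = 6 := by
    rw [hG.card_eigenvalues_pos_eq isUnit_diagonalizer G12_eq_transpose_mul_diagonal_mul,
      filter_pivots_pos]
    rfl
  have hneg : (Finset.univ.filter fun j => hG.eigenvalues j < 0).card = 1 := by
    rw [hG.card_eigenvalues_neg_eq isUnit_diagonalizer G12_eq_transpose_mul_diagonal_mul,
      filter_pivots_neg]
    rfl
  have hne : (Finset.univ.filter fun j => hG.eigenvalues j ≠ 0).card = 7 := by
    rw [Finset.filter_congr fun j _ => (ne_iff_lt_or_gt (a := hG.eigenvalues j) (b := 0)),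
      Finset.filter_or, Finset.card_union_of_disjoint, hneg, hpos]
    exact Finset.disjoint_filter.2 fun _ _ => lt_asymm
  have hsum := Finset.card_filter_add_card_filter_not (s := Finset.univ)
    (fun j => hG.eigenvalues j = 0)
  refine ⟨hpos, hneg, ?_, ?_⟩
  · simp only [← ne_eq, hne, Finset.card_univ, Fintype.card_fin] at hsum
    omega
  · rw [hG.rank_eq_card_non_zero_eigs, Fintype.card_subtype, hne]
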